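/- arXiv:1006.0518 — 2 statements merged into one kernel-verified Lean document; each statement's English description precedes it below -/
import Mathlib

section
/- Suppose r > max(p, q) > s ≥ 1, r is coprime to pq, and r ≡ s (mod pq) or r ≡ −s (mod pq). Then A(p,q,s) ≤ A(p,q,r) ≤ A(p,q,s) + 1. -/
open Polynomial
open scoped Classical

/-- The defining identity of the ternary inclusion-exclusion polynomial `Q_{p,q,r}`:
`Q·(z^{qr}-1)(z^{rp}-1)(z^{pq}-1)(z-1) = (z^{pqr}-1)(z^r-1)(z^q-1)(z^p-1)`. -/
def ternaryId (p q r : ℕ) (Q : Polynomial ℤ) : Prop :=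
  Q * (((X : Polynomial ℤ) ^ (q * r) - 1) * ((X : Polynomial ℤ) ^ (r * p) - 1) *
      ((X : Polynomial ℤ) ^ (p * q) - 1) * ((X : Polynomial ℤ) - 1)) =
    ((X : Polynomial ℤ) ^ (p * q * r) - 1) * ((X : Polynomial ℤ) ^ r - 1) *
      ((X : Polynomial ℤ) ^ q - 1) * ((X : Polynomial ℤ) ^ p - 1)

/-- The coefficient `a_m` of `z^m` in `Q`, indexed by `m : ℤ`, with the convention
that `a_m = 0` for `m < 0` (and automatically `a_m = 0` for `m` beyond the degree). -/
def aCoeff (Q : Polynomial ℤ) (m : ℤ) : ℤ :=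
  if 0 ≤ m then Q.coeff m.toNat else 0

/-- The characteristic function `χ` of integers representable as
`i·qr + j·rp + k·pq` with integers `i, j, k ≥ 0`. -/
noncomputable def chi (p q r : ℕ) (n : ℤ) : ℤ :=
  if ∃ i j k : ℕ, n = (i * (q * r) + j * (r * p) + k * (p * q) : ℕ) then 1 else 0

/-- The indicator function of the numerical semigroup generated by `p` and `q`. -/
noncomputable def semigroupInd (p q k : ℕ) : ℤ :=
  if ∃ a b : ℕ, k = a * p + b * q then 1 else 0

/-- The coefficients of the binary inclusion-exclusion polynomial `Q_{p,q}`. -/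
noncomputable def binaryCoeff (p q i : ℕ) : ℤ :=
  semigroupInd p q i - if 1 ≤ i then semigroupInd p q (i - 1) else 0

/-- The `pq`-periodic coefficients of `(1 - z^p)(1 - z^q) / ((1 - z)(1 - z^{pq}))`. -/
noncomputable def window (p q : ℕ) (k : ℤ) : ℤ :=
  (if k % (p * q) < p then 1 else 0) -
    if q ≤ k % (p * q) ∧ k % (p * q) < p + q then 1 else 0

/-- The contribution of the first `T` coefficients of `Q_{p,q}` to the coefficient of `z^u` in
`Q_{p,q}(z^r) (1 - z^p)(1 - z^q) / ((1 - z)(1 - z^{pq}))`, for `u` and `r` modulo `pq`. -/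
noncomputable def partialCoeff (p q : ℕ) (r u : ℤ) (T : ℕ) : ℤ :=
  ∑ i ∈ Finset.range T, binaryCoeff p q i * window p q (u - r * i)

theorem semigroupInd_eq_zero_or_one (p q k : ℕ) :
    semigroupInd p q k = 0 ∨ semigroupInd p q k = 1 := by
  unfold semigroupInd
  split_ifs <;> simp

theorem semigroupInd_zero (p q : ℕ) : semigroupInd p q 0 = 1 :=
  if_pos ⟨0, 0, by simp⟩

theorem semigroupInd_sub {p q : ℕ} (hpq : p.Coprime q) (hp : 0 < p) (hq : 0 < q) (k : ℕ) :
    semigroupInd p q k - (if q ≤ k then semigroupInd p q (k - q) else 0) =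
      if ∃ a < q, k = p * a then 1 else 0 := by
  by_cases hk : ∃ a < q, k = p * a
  · rw [if_pos hk]
    obtain ⟨a, ha, rfl⟩ := hk
    have h1 : semigroupInd p q (p * a) = 1 := if_pos ⟨a, 0, by ring⟩
    rw [h1]
    split_ifs with h
    · have h2 : semigroupInd p q (p * a - q) = 0 := by
        refine if_neg ?_
        rintro ⟨a', b', hab⟩
        have e : p * a = a' * p + (b' + 1) * q := by
          have : p * a = a' * p + b' * q + q := by omega
          linarith
        have hlt : a' < a := by
          by_contra! hge
          have := Nat.mul_le_mul_left p hge
          have : 0 < (b' + 1) * q := by positivity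
          nlinarith
        obtain ⟨d, rfl⟩ := Nat.exists_eq_add_of_lt hlt
        have e2 : p * (d + 1) = (b' + 1) * q := by nlinarith
        have : q ∣ d + 1 := hpq.symm.dvd_of_dvd_mul_left (Dvd.intro_left _ e2.symm)
        have := Nat.le_of_dvd (by omega) this
        omega
      rw [h2]; norm_num
    · norm_num
  · rw [if_neg hk]
    split_ifs with h
    · have : semigroupInd p q k = semigroupInd p q (k - q) := by
        unfold semigroupInd
        congr 1
        refine propext ⟨?_, ?_⟩
        · rintro ⟨a, b, hab⟩
          rcases Nat.eq_zero_or_pos b with rfl | hb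
          · have haq : q ≤ a := by
              by_contra! hlt
              exact hk ⟨a, hlt, by rw [hab]; ring⟩
            obtain ⟨d, rfl⟩ := Nat.exists_eq_add_of_le haq
            obtain ⟨p', rfl⟩ : ∃ p', p = p' + 1 := ⟨p - 1, by omega⟩
            refine ⟨d, p', ?_⟩
            have : k = d * (p' + 1) + p' * q + q := by rw [hab]; ring
            omega
          · obtain ⟨b', rfl⟩ : ∃ b', b = b' + 1 := ⟨b - 1, by omega⟩
            refine ⟨a, b', ?_⟩
            have : k = a * p + b' * q + q := by rw [hab]; ring
            omega
        · rintro ⟨a, b, hab⟩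
          refine ⟨a, b + 1, ?_⟩
          have : k = a * p + b * q + q := by omega
          rw [this]; ring
      rw [this, sub_self]
    · have : semigroupInd p q k = 0 := by
        refine if_neg ?_
        rintro ⟨a, b, hab⟩
        rcases Nat.eq_zero_or_pos b with rfl | hb
        · refine hk ⟨a, ?_, by rw [hab]; ring⟩
          have := Nat.le_mul_of_pos_right a hp
          omega
        · have := Nat.le_mul_of_pos_left q hb
          omega
      rw [this, sub_zero]

/-- The Frobenius number `pq - p - q` does not lie in the semigroup. -/
theorem semigroupInd_frobenius {p q k : ℕ} (hpq : p.Coprime q) (hq : 0 < q)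
    (hk : k + p + q = p * q) : semigroupInd p q k = 0 := by
  refine if_neg ?_
  rintro ⟨a, b, rfl⟩
  have e : (a + 1) * p + (b + 1) * q = p * q := by linarith
  have h1 : q ∣ a + 1 := by
    refine hpq.symm.dvd_of_dvd_mul_right ?_
    rw [Nat.dvd_add_iff_left (Dvd.intro_left (b + 1) rfl), e]
    exact Dvd.intro_left p rfl
  have h2 := Nat.le_of_dvd (by omega) h1
  nlinarith [Nat.mul_le_mul_right p h2]

theorem sum_range_binaryCoeff_succ (p q T : ℕ) :
    ∑ i ∈ Finset.range (T + 1), binaryCoeff p q i = semigroupInd p q T := by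
  induction T with
  | zero => simp [binaryCoeff]
  | succ T ih =>
    rw [Finset.sum_range_succ, ih]
    simp [binaryCoeff]

theorem sum_range_binaryCoeff_mem (p q T : ℕ) :
    0 ≤ ∑ i ∈ Finset.range T, binaryCoeff p q i ∧
      ∑ i ∈ Finset.range T, binaryCoeff p q i ≤ 1 := by
  cases T with
  | zero => simp
  | succ T =>
    rw [sum_range_binaryCoeff_succ]
    rcases semigroupInd_eq_zero_or_one p q T with h | h <;> simp [h]

theorem abs_sum_Ico_binaryCoeff_le_one (p q a b : ℕ) :
    |∑ i ∈ Finset.Ico a b, binaryCoeff p q i| ≤ 1 := by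
  rcases le_total a b with h | h
  · rw [Finset.sum_Ico_eq_sub _ h, abs_le]
    have h1 := sum_range_binaryCoeff_mem p q a
    have h2 := sum_range_binaryCoeff_mem p q b
    constructor <;> linarith
  · simp [Finset.Ico_eq_empty_of_le h]

theorem exists_sum_Ico_ite_eq {f : ℕ → Prop} (hf : Monotone f) (g : ℕ → ℤ) (a b : ℕ) :
    ∃ c, ∑ i ∈ Finset.Ico a b, g i * (if f i then 1 else 0) = ∑ i ∈ Finset.Ico c b, g i := by
  simp only [mul_ite, mul_one, mul_zero]
  rw [← Finset.sum_filter]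
  by_cases h : ∃ t, f t
  · refine ⟨max a (Nat.find h), Finset.sum_congr ?_ fun _ _ => rfl⟩
    ext i
    have : f i ↔ Nat.find h ≤ i := ⟨Nat.find_min' h, fun hi => hf hi (Nat.find_spec h)⟩
    simp only [Finset.mem_filter, Finset.mem_Ico, this, max_le_iff]
    tauto
  · refine ⟨b, ?_⟩
    have h' : ∀ i, ¬ f i := fun i hi => h ⟨i, hi⟩
    simp [h']

theorem window_eq_of_lt {p q : ℕ} {k : ℤ} (h0 : 0 ≤ k) (hk : k < p * q) :
    window p q k =
      (if k < p then 1 else 0) - if (q : ℤ) ≤ k ∧ k < p + q then 1 else 0 := by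
  rw [window, Int.emod_eq_of_lt h0 hk]

theorem window_congr {p q : ℕ} {k l : ℤ} (h : k ≡ l [ZMOD p * q]) :
    window p q k = window p q l := by
  rw [window, window, h]

theorem partialCoeff_congr {p q : ℕ} {r s u v : ℤ} (h : r ≡ s [ZMOD p * q])
    (huv : u ≡ v [ZMOD p * q]) (T : ℕ) : partialCoeff p q r u T = partialCoeff p q s v T :=
  Finset.sum_congr rfl fun i _ => by rw [window_congr (huv.sub (h.mul_right i))]

theorem window_reflect {p q : ℕ} (hpq : p + q ≤ p * q) (hlt : p < q) (k : ℤ) :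
    window p q (p + q - 1 - k) = -window p q k := by
  have hpos : (0 : ℤ) < p * q := by
    have : 0 < p * q := by omega
    exact_mod_cast this
  have hpq' : (p : ℤ) + q ≤ p * q := by exact_mod_cast hpq
  have h0 := Int.emod_nonneg k hpos.ne'
  have h1 := Int.emod_lt_of_pos k hpos
  have hk : k ≡ k % (p * q) [ZMOD p * q] := (Int.mod_modEq k _).symm
  rw [window_congr hk, window_congr (((Int.ModEq.refl (p + q - 1 : ℤ))).sub hk)]
  generalize k % (p * q) = m at *
  rw [window_eq_of_lt h0 h1]
  by_cases hm : m < p + q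
  · rw [window_eq_of_lt (by omega) (by omega)]
    split_ifs <;> omega
  · rw [window_congr (l := p * q + (p + q - 1 - m)) (by simp [Int.ModEq]),
      window_eq_of_lt (by omega) (by omega)]
    split_ifs <;> omega

theorem partialCoeff_neg {p q : ℕ} (hpq : p + q ≤ p * q) (hlt : p < q) (r u : ℤ) (T : ℕ) :
    partialCoeff p q (-r) u T = -partialCoeff p q r (p + q - 1 - u) T := by
  rw [partialCoeff, partialCoeff, ← Finset.sum_neg_distrib]
  refine Finset.sum_congr rfl fun i _ => ?_
  rw [← mul_neg, ← window_reflect hpq hlt]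
  congr 2
  ring

open scoped PowerSeries in
theorem mk_semigroupInd_mul {p q : ℕ} (hpq : p.Coprime q) (hp : 0 < p) (hq : 0 < q) :
    (1 - (PowerSeries.X : ℤ⟦X⟧) ^ p) * (1 - (PowerSeries.X : ℤ⟦X⟧) ^ q) * PowerSeries.mk (semigroupInd p q) =
      1 - (PowerSeries.X : ℤ⟦X⟧) ^ (p * q) := by
  have h : (1 - (PowerSeries.X : ℤ⟦X⟧) ^ q) * PowerSeries.mk (semigroupInd p q) =
      ∑ a ∈ Finset.range q, ((PowerSeries.X : ℤ⟦X⟧) ^ p) ^ a := by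
    ext k
    rw [sub_mul, one_mul, map_sub, PowerSeries.coeff_X_pow_mul', PowerSeries.coeff_mk, PowerSeries.coeff_mk,
      semigroupInd_sub hpq hp hq, map_sum]
    simp only [← pow_mul, PowerSeries.coeff_X_pow]
    split_ifs with hk
    · obtain ⟨a, ha, rfl⟩ := hk
      rw [Finset.sum_eq_single a]
      · simp
      · intro b _ hb
        rw [if_neg]
        intro e
        exact hb (Nat.eq_of_mul_eq_mul_left hp e).symm
      · simp [ha]
    · refine (Finset.sum_eq_zero fun a ha => if_neg fun e => hk ⟨a, Finset.mem_range.1 ha, e⟩).symm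
  rw [mul_assoc, h, mul_neg_geom_sum, pow_mul]

open scoped PowerSeries in
theorem mk_binaryCoeff (p q : ℕ) :
    PowerSeries.mk (binaryCoeff p q) = (1 - (PowerSeries.X : ℤ⟦X⟧)) * PowerSeries.mk (semigroupInd p q) := by
  ext k
  rw [← pow_one (PowerSeries.X : ℤ⟦X⟧), sub_mul, one_mul, map_sub, PowerSeries.coeff_X_pow_mul']
  simp [binaryCoeff]

open scoped PowerSeries in
theorem mk_window_mul {p q : ℕ} (hpq : p + q ≤ p * q) :
    (1 - (PowerSeries.X : ℤ⟦X⟧)) * ((1 - (PowerSeries.X : ℤ⟦X⟧) ^ (p * q)) * PowerSeries.mk (fun k : ℕ => window p q k)) =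
      (1 - (PowerSeries.X : ℤ⟦X⟧) ^ p) * (1 - (PowerSeries.X : ℤ⟦X⟧) ^ q) := by
  have h : (1 - (PowerSeries.X : ℤ⟦X⟧) ^ (p * q)) * PowerSeries.mk (fun k : ℕ => window p q k) =
      (1 - (PowerSeries.X : ℤ⟦X⟧) ^ q) * ∑ i ∈ Finset.range p, (PowerSeries.X : ℤ⟦X⟧) ^ i := by
    ext k
    rw [sub_mul, one_mul, map_sub, PowerSeries.coeff_X_pow_mul', sub_mul, one_mul, map_sub, PowerSeries.coeff_X_pow_mul']
    simp only [PowerSeries.coeff_mk, map_sum, PowerSeries.coeff_X_pow, Finset.sum_ite_eq,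
      Finset.mem_range]
    by_cases hk : p * q ≤ k
    · rw [if_pos hk, window_congr (l := ((k - p * q : ℕ) : ℤ)), sub_self]
      · split_ifs <;> omega
      · rw [Nat.cast_sub hk]
        simp [Int.ModEq]
    · rw [if_neg hk, window_eq_of_lt (by positivity) (by exact_mod_cast not_le.1 hk)]
      split_ifs <;> omega
  rw [h, mul_left_comm, mul_neg_geom_sum, mul_comm]

open scoped PowerSeries in
theorem coe_eq_of_ternaryId {p q r : ℕ} (hpq : p.Coprime q) (hp : 0 < p) (hq : 0 < q)
    (hle : p + q ≤ p * q) (hr : r ≠ 0) {Q : Polynomial ℤ} (hQ : ternaryId p q r Q) :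
    (Q : ℤ⟦X⟧) = PowerSeries.expand r hr (PowerSeries.mk (binaryCoeff p q)) *
      PowerSeries.mk (fun k : ℕ => window p q k) := by
  have hne : ∀ m : ℕ, m ≠ 0 → (PowerSeries.X : ℤ⟦X⟧) ^ m - 1 ≠ 0 := by
    intro m hm h
    have := congrArg PowerSeries.constantCoeff h
    simp [hm] at this
  have hX : (PowerSeries.X : ℤ⟦X⟧) - 1 ≠ 0 := by simpa using hne 1 one_ne_zero
  have hK : ((PowerSeries.X : ℤ⟦X⟧) ^ (q * r) - 1) * ((PowerSeries.X : ℤ⟦X⟧) ^ (r * p) - 1) *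
      ((PowerSeries.X : ℤ⟦X⟧) ^ (p * q) - 1) * ((PowerSeries.X : ℤ⟦X⟧) - 1) ≠ 0 := by
    refine mul_ne_zero (mul_ne_zero (mul_ne_zero ?_ ?_) ?_) hX <;> apply hne <;> positivity
  refine mul_right_cancel₀ hK ?_
  have h1 := congrArg (fun P : Polynomial ℤ => (P : ℤ⟦X⟧)) hQ
  simp only [Polynomial.coe_mul, Polynomial.coe_sub, Polynomial.coe_pow, Polynomial.coe_X,
    Polynomial.coe_one] at h1
  have h2 := congrArg (PowerSeries.expand r hr) (mk_semigroupInd_mul hpq hp hq)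
  have h3 := congrArg (PowerSeries.expand r hr) (mk_binaryCoeff p q)
  simp only [map_mul, map_sub, map_pow, map_one, PowerSeries.expand_X, ← pow_mul] at h2 h3
  have h4 := mk_window_mul hle
  rw [h1, h3]
  rw [show q * r = r * q by ring, show p * q * r = r * (p * q) by ring]
  set A := PowerSeries.expand r hr (PowerSeries.mk (semigroupInd p q))
  set B := PowerSeries.mk (fun k : ℕ => window p q k)
  linear_combination (-(1 - (PowerSeries.X : ℤ⟦X⟧) ^ r)) * (((1 - (PowerSeries.X : ℤ⟦X⟧)) *
    ((1 - (PowerSeries.X : ℤ⟦X⟧) ^ (p * q)) * B)) * h2 + (1 - (PowerSeries.X : ℤ⟦X⟧) ^ (r * (p * q))) * h4)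

theorem coeff_eq_partialCoeff {p q r : ℕ} (hpq : p.Coprime q) (hp : 0 < p) (hq : 0 < q)
    (hle : p + q ≤ p * q) (hr : r ≠ 0) {Q : Polynomial ℤ} (hQ : ternaryId p q r Q) (n : ℕ) :
    Q.coeff n = partialCoeff p q r n (n / r + 1) := by
  rw [← Polynomial.coeff_coe, coe_eq_of_ternaryId hpq hp hq hle hr hQ, PowerSeries.coeff_mul,
    Finset.Nat.sum_antidiagonal_eq_sum_range_succ_mk, partialCoeff]
  symm
  refine Finset.sum_of_injOn (fun i => r * i) ?_ ?_ ?_ ?_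
  · intro i _ j _ h
    exact Nat.eq_of_mul_eq_mul_left (Nat.pos_of_ne_zero hr) h
  · intro i hi
    simp only [Finset.coe_range, Set.mem_Iio] at hi ⊢
    have := (Nat.le_div_iff_mul_le (Nat.pos_of_ne_zero hr)).1 (Nat.lt_succ_iff.1 hi)
    rw [mul_comm] at this
    omega
  · intro j hj hj'
    rw [PowerSeries.coeff_expand_of_not_dvd, zero_mul]
    rintro ⟨i, rfl⟩
    refine hj' ⟨i, ?_, rfl⟩
    simp only [Finset.mem_range, Finset.coe_range, Set.mem_Iio] at hj ⊢
    refine Nat.lt_succ_of_le ((Nat.le_div_iff_mul_le (Nat.pos_of_ne_zero hr)).2 ?_)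
    rw [mul_comm]; omega
  · intro i hi
    simp only [Finset.mem_range] at hi
    have := (Nat.le_div_iff_mul_le (Nat.pos_of_ne_zero hr)).1 (Nat.lt_succ_iff.1 hi)
    rw [mul_comm] at this
    simp only [PowerSeries.coeff_expand_mul, PowerSeries.coeff_mk]
    rw [Nat.cast_sub this]
    push_cast
    rfl

/-- When `r ≥ p + q`, every nonzero partial coefficient is an actual coefficient. -/
theorem exists_partialCoeff_eq {p q r : ℕ} (hlt : p < q) (hle : p + q ≤ p * q) (hr : p + q ≤ r)
    (u : ℤ) (T : ℕ) :
    partialCoeff p q r u T = 0 ∨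
      ∃ n : ℕ, partialCoeff p q r u T = partialCoeff p q r n (n / r + 1) := by
  have hpos : (0 : ℤ) < p * q := by
    have : 0 < p * q := by omega
    exact_mod_cast this
  induction T with
  | zero => simp [partialCoeff]
  | succ T ih =>
    by_cases hw : window p q (u - r * T) = 0
    · have : partialCoeff p q r u (T + 1) = partialCoeff p q r u T := by
        rw [partialCoeff, Finset.sum_range_succ, hw, mul_zero, add_zero, partialCoeff]
      rwa [this]
    · right
      have h0 := Int.emod_nonneg (u - r * T) hpos.ne'
      obtain ⟨m, hm⟩ := Int.eq_ofNat_of_zero_le h0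
      have hmlt : m < p + q := by
        by_contra! hge
        refine hw ?_
        rw [window, hm]
        split_ifs <;> omega
      refine ⟨r * T + m, ?_⟩
      rw [Nat.mul_add_div (by omega), Nat.div_eq_of_lt (by omega), add_zero]
      refine partialCoeff_congr rfl ?_ _
      have h1 : u - r * T ≡ m [ZMOD p * q] := by
        rw [← hm]; exact (Int.mod_modEq _ _).symm
      have := h1.add_left (r * T)
      push_cast
      simpa using this

theorem partialCoeff_sub (p q : ℕ) (r u : ℤ) {T T' : ℕ} (h : T ≤ T') :
    partialCoeff p q r u T' - partialCoeff p q r u T =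
      ∑ i ∈ Finset.Ico T T', binaryCoeff p q i * window p q (u - r * i) :=
  (Finset.sum_Ico_eq_sub _ h).symm

theorem abs_partialCoeff_sub_le_one_of_lt {p q s T m : ℕ} (hlt : p < q) (hle : p + q ≤ p * q)
    (hs : 0 < s) (hm : m < q) :
    |partialCoeff p q s (s * T + m : ℕ) T -
      partialCoeff p q s (s * T + m : ℕ) ((s * T + m) / s + 1)| ≤ 1 := by
  have hT : T ≤ (s * T + m) / s + 1 := by
    rw [Nat.mul_add_div hs]
    exact (Nat.le_add_right _ _).trans (Nat.le_succ _)
  rw [abs_sub_comm, partialCoeff_sub p q _ _ hT]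
  have hf : Monotone fun i => s * T + m < p + s * i := fun i j hij h =>
    lt_of_lt_of_le h (Nat.add_le_add_left (Nat.mul_le_mul_left s hij) p)
  obtain ⟨c, hc⟩ := exists_sum_Ico_ite_eq hf (binaryCoeff p q) T ((s * T + m) / s + 1)
  have e : ∑ i ∈ Finset.Ico T ((s * T + m) / s + 1),
      binaryCoeff p q i * window p q ((s * T + m : ℕ) - s * i) =
      ∑ i ∈ Finset.Ico c ((s * T + m) / s + 1), binaryCoeff p q i := by
    rw [← hc]
    refine Finset.sum_congr rfl fun i hi => ?_
    rw [Finset.mem_Ico] at hi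
    have h1 : s * T ≤ s * i := Nat.mul_le_mul_left s hi.1
    have h2 := (Nat.le_div_iff_mul_le hs).1 (Nat.lt_succ_iff.1 hi.2)
    rw [mul_comm] at h2
    have h3 : ((s * T + m : ℕ) : ℤ) - s * i = ((s * T + m - s * i : ℕ) : ℤ) := by
      rw [Nat.cast_sub h2]; push_cast; rfl
    have h4 : ((s * T + m - s * i : ℕ) : ℤ) < p * q := by
      have : s * T + m - s * i < p * q := by omega
      exact_mod_cast this
    rw [h3, window_eq_of_lt (by positivity) h4]
    congr 1
    split_ifs <;> omega
  rw [e]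
  exact abs_sum_Ico_binaryCoeff_le_one p q _ _

theorem abs_partialCoeff_sub_le_one_of_le {p q s T T' n : ℕ} (hlt : p < q) (hT : T' ≤ T)
    (hn : s * T + q ≤ n) (hn' : ∀ i, T' ≤ i → n < p * q + s * i) :
    |partialCoeff p q s n T - partialCoeff p q s n T'| ≤ 1 := by
  rw [partialCoeff_sub p q _ _ hT]
  have hf : Monotone fun i => n < p + q + s * i := fun i j hij h =>
    lt_of_lt_of_le h (Nat.add_le_add_left (Nat.mul_le_mul_left s hij) _)
  obtain ⟨c, hc⟩ := exists_sum_Ico_ite_eq hf (binaryCoeff p q) T' T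
  have e : ∑ i ∈ Finset.Ico T' T, binaryCoeff p q i * window p q (n - s * i) =
      -∑ i ∈ Finset.Ico c T, binaryCoeff p q i := by
    rw [← hc, ← Finset.sum_neg_distrib]
    refine Finset.sum_congr rfl fun i hi => ?_
    rw [Finset.mem_Ico] at hi
    have h1 : s * i ≤ s * T := Nat.mul_le_mul_left s hi.2.le
    have h2 := hn' i hi.1
    have h3 : (n : ℤ) - s * i = ((n - s * i : ℕ) : ℤ) := by
      rw [Nat.cast_sub (by omega)]; push_cast; rfl
    have h4 : ((n - s * i : ℕ) : ℤ) < p * q := by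
      have : n - s * i < p * q := by omega
      exact_mod_cast this
    rw [h3, window_eq_of_lt (by positivity) h4, ← mul_neg]
    congr 1
    split_ifs <;> omega
  rw [e, abs_neg]
  exact abs_sum_Ico_binaryCoeff_le_one p q _ _

/-- Every partial coefficient is within `1` of zero or of an actual coefficient. -/
theorem exists_abs_partialCoeff_sub_le_one {p q s : ℕ} (hlt : p < q) (hle : p + q ≤ p * q)
    (hs : 0 < s) (u : ℤ) (T : ℕ) :
    |partialCoeff p q s u T| ≤ 1 ∨ ∃ n : ℕ, u ≡ n [ZMOD p * q] ∧
      |partialCoeff p q s u T - partialCoeff p q s n (n / s + 1)| ≤ 1 ∧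
      (n = 0 → s * T + q ≤ p * q) := by
  have hpos : (0 : ℤ) < p * q := by
    have : 0 < p * q := by omega
    exact_mod_cast this
  obtain ⟨m, hm⟩ := Int.eq_ofNat_of_zero_le (Int.emod_nonneg (u - s * T) hpos.ne')
  have hmlt : m < p * q := by
    have := Int.emod_lt_of_pos (u - s * T) hpos
    rw [hm] at this
    exact_mod_cast this
  have hu : u ≡ (s * T + m : ℕ) [ZMOD p * q] := by
    have h1 : u - s * T ≡ m [ZMOD p * q] := by
      rw [← hm]; exact (Int.mod_modEq _ _).symm
    have := h1.add_left (s * T)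
    push_cast
    simpa using this
  rcases lt_or_ge m q with hmq | hmq
  · right
    refine ⟨s * T + m, hu, ?_, by omega⟩
    rw [partialCoeff_congr rfl hu]
    exact abs_partialCoeff_sub_le_one_of_lt hlt hle hs hmq
  rcases lt_or_ge (s * T + m) (p * q) with hn | hn
  · left
    rw [partialCoeff_congr rfl hu]
    have := abs_partialCoeff_sub_le_one_of_le (s := s) (n := s * T + m) hlt (Nat.zero_le T)
      (by omega) (fun i _ => by omega)
    simpa [partialCoeff] using this
  · right
    have hv : ((s * T + m - p * q : ℕ) : ℤ) ≡ (s * T + m : ℕ) [ZMOD p * q] := by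
      rw [Nat.cast_sub hn]
      simp [Int.ModEq]
    refine ⟨s * T + m - p * q, hu.trans hv.symm, ?_, fun h => by omega⟩
    rw [partialCoeff_congr rfl hu, partialCoeff_congr rfl hv]
    refine abs_partialCoeff_sub_le_one_of_le (n := s * T + m) hlt ?_ (by omega) fun i hi => ?_
    · refine Nat.succ_le_of_lt ((Nat.div_lt_iff_lt_mul hs).2 ?_)
      rw [mul_comm T s]; omega
    · have := (Nat.div_lt_iff_lt_mul hs).1 (Nat.lt_of_succ_le hi)
      rw [mul_comm i s] at this
      omega

theorem partialCoeff_one_zero {p q : ℕ} (hpq : p.Coprime q) (hp : 0 < p) (hlt : p < q)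
    (hle : p + q ≤ p * q) (T : ℕ) (hT : T + 1 + q ≤ p * q) :
    partialCoeff p q 1 0 (T + 1) =
      1 - if p * q < T + p + q then semigroupInd p q T else 0 := by
  induction T with
  | zero =>
    rw [if_neg (by omega), partialCoeff, Finset.sum_range_one, window_eq_of_lt (by simp)]
    · simp [binaryCoeff, semigroupInd_zero]
      omega
    · have : 0 < p * q := by omega
      simpa using (by exact_mod_cast this : (0 : ℤ) < p * q)
  | succ T ih =>
    have h := ih (by omega)
    have h0 : T + p + q = p * q → semigroupInd p q T = 0 :=
      semigroupInd_frobenius hpq (by omega)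
    obtain ⟨m, hm⟩ := Nat.exists_eq_add_of_le (by omega : T + 1 ≤ p * q)
    have hm' : (p : ℤ) * q = T + 1 + m := by exact_mod_cast hm
    have hw : window p q (0 - 1 * ((T + 1 : ℕ) : ℤ)) = if m < p + q then -1 else 0 := by
      rw [window_congr (l := (m : ℤ)), window_eq_of_lt (by positivity) (by omega)]
      · split_ifs <;> omega
      · rw [show (m : ℤ) = 0 - 1 * ((T + 1 : ℕ) : ℤ) + p * q by push_cast; linarith]
        simp [Int.ModEq]
    rw [partialCoeff] at h ⊢
    rw [Finset.sum_range_succ, h, hw, binaryCoeff, if_pos (by omega : 1 ≤ T + 1), Nat.add_sub_cancel]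
    by_cases hT' : T + p + q = p * q
    · rw [h0 hT']
      split_ifs <;> omega
    · split_ifs <;> omega

theorem ternaryId_one (p q : ℕ) : ternaryId p q 1 1 := by
  unfold ternaryId
  ring

theorem abs_partialCoeff_one_le_one {p q : ℕ} (hpq : p.Coprime q) (hp : 0 < p) (hlt : p < q)
    (hle : p + q ≤ p * q) (u : ℤ) (T : ℕ) : |partialCoeff p q 1 u T| ≤ 1 := by
  rcases exists_abs_partialCoeff_sub_le_one (s := 1) hlt hle one_pos u T with h | ⟨n, hn, h, h0⟩
  · exact_mod_cast h
  rw [← coeff_eq_partialCoeff hpq hp (by omega) hle one_ne_zero (ternaryId_one p q)] at h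
  rcases Nat.eq_zero_or_pos n with rfl | hpos
  · have h1 := h0 rfl
    rw [partialCoeff_congr rfl hn]
    cases T with
    | zero => simp [partialCoeff]
    | succ T =>
      rw [Nat.cast_zero, partialCoeff_one_zero hpq hp hlt hle T (by omega)]
      rcases semigroupInd_eq_zero_or_one p q T with h | h <;> rw [h] <;> split_ifs <;> simp
  · rw [Polynomial.coeff_one, if_neg (by omega), sub_zero] at h
    exact_mod_cast h

theorem height_bounds_of_lt {p q r s : ℕ} (hp : 0 < p) (hlt : p < q) (hle : p + q ≤ p * q)
    (hpq : p.Coprime q) (hr : p + q ≤ r)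
    (hmod : (r : ℤ) ≡ s [ZMOD p * q] ∨ (r : ℤ) ≡ -s [ZMOD p * q])
    {Qr : Polynomial ℤ} (hQr : ternaryId p q r Qr)
    {Ar : ℤ} (hAr : IsGreatest {a : ℤ | ∃ m : ℕ, |Qr.coeff m| = a} Ar)
    {Qs : Polynomial ℤ} (hQs : 2 ≤ s → ternaryId p q s Qs) {As : ℤ}
    (hAs : (s = 1 ∧ As = 0) ∨
      (2 ≤ s ∧ IsGreatest {a : ℤ | ∃ m : ℕ, |Qs.coeff m| = a} As)) :
    As ≤ Ar ∧ Ar ≤ As + 1 := by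
  have hcr := coeff_eq_partialCoeff hpq hp (by omega) hle (by omega) hQr
  have hAr' : ∀ n, |Qr.coeff n| ≤ Ar := fun n => hAr.2 ⟨n, rfl⟩
  have hrs : ∀ u T, ∃ v, |partialCoeff p q r u T| = |partialCoeff p q s v T| := by
    intro u T
    rcases hmod with h | h
    · exact ⟨u, by rw [partialCoeff_congr h rfl]⟩
    · exact ⟨p + q - 1 - u, by rw [partialCoeff_congr h rfl, partialCoeff_neg hle hlt, abs_neg]⟩
  have hsr : ∀ u T, ∃ v, |partialCoeff p q s u T| = |partialCoeff p q r v T| := by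
    intro u T
    rcases hmod with h | h
    · exact ⟨u, by rw [partialCoeff_congr h rfl]⟩
    · refine ⟨p + q - 1 - u, ?_⟩
      rw [partialCoeff_congr h rfl, partialCoeff_neg hle hlt, abs_neg, sub_sub_cancel]
  obtain ⟨m, hm⟩ := hAr.1
  have hAr0 : 0 ≤ Ar := hm ▸ abs_nonneg _
  obtain ⟨v, hv⟩ := hrs m (m / r + 1)
  rw [hcr, hv] at hm
  rcases hAs with ⟨rfl, rfl⟩ | ⟨hs2, hAs⟩
  · refine ⟨hAr0, ?_⟩
    rw [← hm, zero_add]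
    exact_mod_cast abs_partialCoeff_one_le_one hpq hp hlt hle v _
  · have hcs := coeff_eq_partialCoeff hpq hp (by omega) hle (by omega) (hQs hs2)
    obtain ⟨k, hk⟩ := hAs.1
    have hAs0 : 0 ≤ As := hk ▸ abs_nonneg _
    constructor
    · rw [hcs] at hk
      obtain ⟨w, hw⟩ := hsr k (k / s + 1)
      rw [← hk, hw]
      rcases exists_partialCoeff_eq hlt hle hr w (k / s + 1) with h | ⟨n, h⟩
      · rwa [h, abs_zero]
      · rw [h, ← hcr]
        exact hAr' n
    · rw [← hm]
      rcases exists_abs_partialCoeff_sub_le_one hlt hle (by omega : 0 < s) v (m / r + 1) with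
        h | ⟨n, -, h, -⟩
      · linarith
      · rw [← hcs] at h
        have h1 : |Qs.coeff n| ≤ As := hAs.2 ⟨n, rfl⟩
        have h2 := abs_sub_abs_le_abs_sub (partialCoeff p q s v (m / r + 1)) (Qs.coeff n)
        linarith

theorem ternaryId_swap {p q r : ℕ} {Q : Polynomial ℤ} (h : ternaryId p q r Q) :
    ternaryId q p r Q := by
  unfold ternaryId at h ⊢
  rw [mul_comm r q, mul_comm p r, mul_comm q p]
  rw [mul_comm r p] at h
  linear_combination h

theorem add_le_of_modEq {p q r s : ℕ} (hp : 3 ≤ p) (hlt : p < q) (hs : s < q) (hr : q < r)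
    (hmod : (r : ℤ) ≡ s [ZMOD p * q] ∨ (r : ℤ) ≡ -s [ZMOD p * q]) : p + q ≤ r := by
  have h1 : p + 2 * q ≤ p * q + 1 := by
    obtain ⟨p, rfl⟩ := Nat.exists_eq_add_of_le hp
    nlinarith
  have key : ∀ t : ℤ, 0 < t → (p * q : ℤ) ∣ t → (p : ℤ) * q ≤ t := fun t ht h =>
    Int.le_of_dvd ht h
  have h1' : (p : ℤ) + 2 * q ≤ p * q + 1 := by exact_mod_cast h1
  rcases hmod with h | h
  · have := key (r - s) (by omega) h.symm.dvd
    omega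
  · have := key (r + s) (by omega) (by simpa using h.symm.dvd)
    omega

/-- If `r > max(p,q) > s ≥ 1` and `r ≡ ±s (mod pq)`, then
`A(p,q,s) ≤ A(p,q,r) ≤ A(p,q,s) + 1` (with the conventions `A(p,q,1) = 0` and
`A(p,q,2)` the height of the inclusion-exclusion polynomial `Q_{p,q,2}`). -/
theorem stmt_7 (p q r s : ℕ) (hp : 3 ≤ p) (hq : 3 ≤ q) (hr3 : 3 ≤ r)
    (hpq : Nat.Coprime p q) (hrc : Nat.Coprime r (p * q))
    (hs1 : 1 ≤ s) (hsmax : s < max p q) (hrmax : max p q < r)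
    (hmod : (r : ℤ) ≡ (s : ℤ) [ZMOD ((p : ℤ) * q)] ∨
      (r : ℤ) ≡ -(s : ℤ) [ZMOD ((p : ℤ) * q)])
    (Qr : Polynomial ℤ) (hQr : ternaryId p q r Qr)
    (Ar : ℤ) (hAr : IsGreatest {a : ℤ | ∃ m : ℕ, |Qr.coeff m| = a} Ar)
    (Qs : Polynomial ℤ) (hQs : 2 ≤ s → ternaryId p q s Qs)
    (As : ℤ)
    (hAs : (s = 1 ∧ As = 0) ∨
      (2 ≤ s ∧ IsGreatest {a : ℤ | ∃ m : ℕ, |Qs.coeff m| = a} As)) :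
    As ≤ Ar ∧ Ar ≤ As + 1 := by
  have hle : p + q ≤ p * q := by nlinarith
  rcases lt_trichotomy p q with hlt | rfl | hlt
  · rw [max_eq_right hlt.le] at hsmax hrmax
    exact height_bounds_of_lt (by omega) hlt hle hpq
      (add_le_of_modEq hp hlt hsmax hrmax hmod) hmod hQr hAr hQs hAs
  · rw [Nat.coprime_self] at hpq
    omega
  · rw [max_eq_left hlt.le] at hsmax hrmax
    rw [mul_comm (p : ℤ)] at hmod
    exact height_bounds_of_lt (by omega) hlt (by linarith) hpq.symm
      (add_le_of_modEq hq hlt hsmax hrmax hmod) hmod (ternaryId_swap hQr) hAr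
      (fun h => ternaryId_swap (hQs h)) hAs
end

section
/- Suppose r, s > max(p, q), both r and s are ≥ 3 and coprime to pq, and r ≡ s (mod pq). Then A⁺(p,q,r) = A⁺(p,q,s) and A⁻(p,q,r) = A⁻(p,q,s). -/
open Polynomial
open scoped Classical

/-- The power series `∑ z^{dn}`, inverse to `1 - z^d`. -/
noncomputable def geomSeries (d : ℕ) (hd : d ≠ 0) : PowerSeries ℤ :=
  PowerSeries.expand d hd (PowerSeries.mk 1)

lemma geomSeries_mul_one_sub (d : ℕ) (hd : d ≠ 0) :
    geomSeries d hd * (1 - PowerSeries.X ^ d) = 1 := by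
  have h := congrArg (PowerSeries.expand d hd) (PowerSeries.mk_one_mul_one_sub_eq_one ℤ)
  simpa [geomSeries] using h

lemma coeff_X_pow_mul_geomSeries (d : ℕ) (hd : d ≠ 0) (k n : ℕ) :
    (PowerSeries.X ^ k * geomSeries d hd).coeff n = if k ≤ n ∧ n ≡ k [MOD d] then 1 else 0 := by
  rw [PowerSeries.coeff_X_pow_mul', geomSeries, PowerSeries.coeff_expand]
  by_cases h : k ≤ n
  · have : n ≡ k [MOD d] ↔ d ∣ n - k := by rw [Nat.ModEq.comm, Nat.modEq_iff_dvd' h]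
    simp [h, this]
  · simp [h]

/-- The generating series of the numerical semigroup generated by `p` and `q`,
when `p` and `q` are coprime. -/
noncomputable def semigroupSeries (p q : ℕ) (hq : q ≠ 0) : PowerSeries ℤ :=
  (∑ a ∈ Finset.range q, (PowerSeries.X ^ p) ^ a) * geomSeries q hq

lemma semigroupSeries_mul (p q : ℕ) (hq : q ≠ 0) :
    semigroupSeries p q hq * ((1 - PowerSeries.X ^ q) * (1 - PowerSeries.X ^ p)) =
      1 - PowerSeries.X ^ (p * q) := by
  have h1 := geomSeries_mul_one_sub q hq
  have h2 := geom_sum_mul_neg ((PowerSeries.X : PowerSeries ℤ) ^ p) q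
  rw [pow_mul, ← h2, semigroupSeries]
  linear_combination (∑ a ∈ Finset.range q, ((PowerSeries.X : PowerSeries ℤ) ^ p) ^ a) *
    (1 - PowerSeries.X ^ p) * h1

lemma coeff_semigroupSeries_mem (p q : ℕ) (hq : q ≠ 0) (hpq : Nat.Coprime p q) (n : ℕ) :
    0 ≤ (semigroupSeries p q hq).coeff n ∧ (semigroupSeries p q hq).coeff n ≤ 1 := by
  have h : (semigroupSeries p q hq).coeff n =
      (((Finset.range q).filter fun a => p * a ≤ n ∧ n ≡ p * a [MOD q]).card : ℤ) := by
    rw [semigroupSeries, Finset.sum_mul, map_sum, Finset.card_filter]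
    push_cast
    refine Finset.sum_congr rfl fun a _ => ?_
    rw [← pow_mul, coeff_X_pow_mul_geomSeries]
  rw [h]
  refine ⟨by positivity, ?_⟩
  have : ((Finset.range q).filter fun a => p * a ≤ n ∧ n ≡ p * a [MOD q]).card ≤ 1 := by
    rw [Finset.card_le_one]
    intro a ha b hb
    simp only [Finset.mem_filter, Finset.mem_range] at ha hb
    have hab : p * a ≡ p * b [MOD q] := ha.2.2.symm.trans hb.2.2
    exact (Nat.ModEq.cancel_left_of_coprime hpq.symm hab).eq_of_lt_of_lt ha.1 hb.1
  exact_mod_cast this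

/-- The coefficients of the binary inclusion-exclusion polynomial `Q_{p,q}`. -/
noncomputable def binCoeff (p q : ℕ) (hq : q ≠ 0) (n : ℕ) : ℤ :=
  (semigroupSeries p q hq * (1 - PowerSeries.X)).coeff n

lemma binCoeff_zero (p q : ℕ) (hq : q ≠ 0) :
    binCoeff p q hq 0 = (semigroupSeries p q hq).coeff 0 := by
  simp [binCoeff]

lemma binCoeff_succ (p q : ℕ) (hq : q ≠ 0) (n : ℕ) :
    binCoeff p q hq (n + 1) =
      (semigroupSeries p q hq).coeff (n + 1) - (semigroupSeries p q hq).coeff n := by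
  simp [binCoeff, mul_sub, PowerSeries.coeff_succ_mul_X]

lemma binCoeff_succ_nonneg (p q : ℕ) (hq : q ≠ 0) (hpq : Nat.Coprime p q) (n : ℕ)
    (h : binCoeff p q hq n < 0) : 0 ≤ binCoeff p q hq (n + 1) := by
  have h1 := coeff_semigroupSeries_mem p q hq hpq
  have h3 := h1 (n + 1)
  rw [binCoeff_succ]
  cases n with
  | zero => rw [binCoeff_zero] at h; have := h1 0; omega
  | succ n => rw [binCoeff_succ] at h; have := h1 n; have := h1 (n + 1); omega

lemma binCoeff_succ_nonpos (p q : ℕ) (hq : q ≠ 0) (hpq : Nat.Coprime p q) (n : ℕ)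
    (h : 0 < binCoeff p q hq n) : binCoeff p q hq (n + 1) ≤ 0 := by
  have h1 := coeff_semigroupSeries_mem p q hq hpq
  have h3 := h1 (n + 1)
  rw [binCoeff_succ]
  cases n with
  | zero => rw [binCoeff_zero] at h; have := h1 0; omega
  | succ n => rw [binCoeff_succ] at h; have := h1 n; have := h1 (n + 1); omega

/-- The `pq`-periodic extension of the coefficients of `(1 - z^p)(1 - z^q)/(1 - z)`. -/
noncomputable def perCoeff (p q : ℕ) (k : ℤ) : ℤ :=
  (if k % (p * q : ℕ) < p then 1 else 0) -
    (if q ≤ k % (p * q : ℕ) ∧ k % (p * q : ℕ) < p + q then 1 else 0)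

lemma perCoeff_congr (p q : ℕ) {k l : ℤ} (h : k ≡ l [ZMOD (p * q : ℕ)]) :
    perCoeff p q k = perCoeff p q l := by
  unfold perCoeff
  rw [h.eq]

lemma add_lt_mul_of_three_le {p q : ℕ} (hp : 3 ≤ p) (hq : 3 ≤ q) : p + q < p * q := by
  nlinarith

/-- The power series whose coefficients are `perCoeff`. -/
noncomputable def perSeries (p q : ℕ) (hpq : p * q ≠ 0) : PowerSeries ℤ :=
  ((∑ i ∈ Finset.range p, PowerSeries.X ^ i) * (1 - PowerSeries.X ^ q)) * geomSeries (p * q) hpq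

lemma perSeries_mul (p q : ℕ) (hpq : p * q ≠ 0) :
    perSeries p q hpq * ((1 - PowerSeries.X ^ (p * q)) * (1 - PowerSeries.X)) =
      (1 - PowerSeries.X ^ p) * (1 - PowerSeries.X ^ q) := by
  have h1 := geomSeries_mul_one_sub (p * q) hpq
  have h2 := geom_sum_mul_neg (PowerSeries.X : PowerSeries ℤ) p
  rw [← h2, perSeries]
  linear_combination (∑ i ∈ Finset.range p, (PowerSeries.X : PowerSeries ℤ) ^ i) *
    (1 - PowerSeries.X ^ q) * (1 - PowerSeries.X) * h1

lemma coeff_X_pow_mul_geomSeries_of_lt {d : ℕ} (hd : d ≠ 0) {k : ℕ} (hk : k < d) (n : ℕ) :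
    (PowerSeries.X ^ k * geomSeries d hd).coeff n = if n % d = k then 1 else 0 := by
  rw [coeff_X_pow_mul_geomSeries]
  congr 1
  rw [Nat.ModEq, Nat.mod_eq_of_lt hk, eq_iff_iff, and_iff_right_iff_imp]
  rintro rfl
  exact Nat.mod_le _ _

lemma coeff_perSeries {p q : ℕ} (hp : 3 ≤ p) (hq : 3 ≤ q) (hpq : p * q ≠ 0) (n : ℕ) :
    (perSeries p q hpq).coeff n = perCoeff p q n := by
  have hlt := add_lt_mul_of_three_le hp hq
  have h : perSeries p q hpq =
      (∑ i ∈ Finset.range p, PowerSeries.X ^ i * geomSeries (p * q) hpq) -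
        ∑ i ∈ Finset.range p, PowerSeries.X ^ (q + i) * geomSeries (p * q) hpq := by
    rw [perSeries, ← Finset.sum_mul, ← Finset.sum_mul]
    simp_rw [pow_add]
    rw [← Finset.mul_sum]
    ring
  rw [h, map_sub, map_sum, map_sum, perCoeff]
  congr 1
  · rw [Finset.sum_congr rfl fun i hi =>
      coeff_X_pow_mul_geomSeries_of_lt hpq (by have := Finset.mem_range.1 hi; omega) n]
    simp only [Finset.sum_ite_eq, Finset.mem_range]
    norm_cast
  · rw [Finset.sum_congr rfl fun i hi =>
      coeff_X_pow_mul_geomSeries_of_lt hpq (by have := Finset.mem_range.1 hi; omega) n]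
    rw [← Int.natCast_mod]
    generalize n % (p * q) = w
    by_cases hw : q ≤ w
    · obtain ⟨v, rfl⟩ := Nat.exists_eq_add_of_le hw
      simp only [Nat.add_left_cancel_iff, Finset.sum_ite_eq, Finset.mem_range]
      congr 1
      rw [eq_iff_iff]
      omega
    · rw [Finset.sum_eq_zero fun i _ => if_neg (by omega), if_neg (by omega)]

/-- The partial sum `∑_{i < t} c i * g (u - r i)`, where `g` is `perCoeff`. -/
noncomputable def kaplanSum (p q : ℕ) (c : ℕ → ℤ) (r : ℕ) (u : ℤ) (t : ℕ) : ℤ :=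
  ∑ i ∈ Finset.range t, c i * perCoeff p q (u - r * i)

lemma kaplanSum_succ (p q : ℕ) (c : ℕ → ℤ) (r : ℕ) (u : ℤ) (t : ℕ) :
    kaplanSum p q c r u (t + 1) =
      kaplanSum p q c r u t + c t * perCoeff p q (u - r * t) :=
  Finset.sum_range_succ _ _

lemma kaplanSum_neg (p q : ℕ) (c : ℕ → ℤ) (r : ℕ) (u : ℤ) (t : ℕ) :
    kaplanSum p q (fun i => -c i) r u t = -kaplanSum p q c r u t := by
  simp [kaplanSum]

lemma kaplanSum_congr (p q : ℕ) (c : ℕ → ℤ) {r s : ℕ} (h : r ≡ s [MOD p * q]) {u v : ℤ}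
    (huv : u ≡ v [ZMOD (p * q : ℕ)]) (t : ℕ) :
    kaplanSum p q c r u t = kaplanSum p q c s v t := by
  refine Finset.sum_congr rfl fun i _ => ?_
  rw [perCoeff_congr p q (huv.sub (((Int.natCast_modEq_iff).2 h).mul_right _))]

lemma ternaryId_series {p q r : ℕ} (hq : q ≠ 0) (hpq : p * q ≠ 0) (hr : r ≠ 0)
    {Q : Polynomial ℤ} (hQ : ternaryId p q r Q) :
    (Q : PowerSeries ℤ) =
      PowerSeries.expand r hr (semigroupSeries p q hq * (1 - PowerSeries.X)) *
        perSeries p q hpq := by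
  have hne : ∀ d : ℕ, d ≠ 0 → (1 - (PowerSeries.X : PowerSeries ℤ) ^ d) ≠ 0 := fun d hd h => by
    simpa [h] using geomSeries_mul_one_sub d hd
  have hp : p ≠ 0 := fun h => hpq (by simp [h])
  have hQ' := congrArg (fun P : Polynomial ℤ => (P : PowerSeries ℤ)) hQ
  simp only [Polynomial.coe_mul, Polynomial.coe_sub, Polynomial.coe_pow, Polynomial.coe_X,
    Polynomial.coe_one] at hQ'
  have h1 := congrArg (PowerSeries.expand r hr) (semigroupSeries_mul p q hq)
  simp only [map_mul, map_sub, map_one, map_pow, PowerSeries.expand_X, ← pow_mul] at h1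
  have h2 := perSeries_mul p q hpq
  have hD : (1 - (PowerSeries.X : PowerSeries ℤ) ^ (q * r)) * (1 - PowerSeries.X ^ (r * p)) *
      (1 - PowerSeries.X ^ (p * q)) * (1 - PowerSeries.X) ≠ 0 := by
    have h3 := hne 1 one_ne_zero
    rw [pow_one] at h3
    exact mul_ne_zero (mul_ne_zero (mul_ne_zero (hne _ (mul_ne_zero hq hr))
      (hne _ (mul_ne_zero hr hp))) (hne _ hpq)) h3
  apply mul_right_cancel₀ hD
  simp only [map_mul, map_sub, map_one, PowerSeries.expand_X]
  rw [mul_comm q r] at hQ' ⊢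
  rw [mul_comm (p * q) r] at hQ'
  linear_combination hQ' - (1 - PowerSeries.X ^ r) * (perSeries p q hpq *
    ((1 - PowerSeries.X ^ (p * q)) * (1 - PowerSeries.X))) * h1 -
    (1 - PowerSeries.X ^ r) * (1 - PowerSeries.X ^ (r * (p * q))) * h2

/-- Kaplan's formula for the coefficients of a ternary inclusion-exclusion polynomial. -/
lemma ternaryId_coeff {p q r : ℕ} (hp : 3 ≤ p) (hq : 3 ≤ q) (hq0 : q ≠ 0) (hr : r ≠ 0)
    {Q : Polynomial ℤ} (hQ : ternaryId p q r Q) (n : ℕ) :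
    Q.coeff n = kaplanSum p q (binCoeff p q hq0) r n (n / r + 1) := by
  have hpq : p * q ≠ 0 := by positivity
  rw [← Polynomial.coeff_coe, ternaryId_series hq0 hpq hr hQ, PowerSeries.coeff_mul,
    Finset.Nat.sum_antidiagonal_eq_sum_range_succ_mk, kaplanSum]
  symm
  apply Finset.sum_of_injOn (fun i => r * i)
  · intro a _ b _ hab
    exact Nat.eq_of_mul_eq_mul_left (Nat.pos_of_ne_zero hr) hab
  · intro i hi
    simp only [Finset.coe_range, Set.mem_Iio] at hi ⊢
    have := Nat.mul_le_of_le_div r i n (by omega)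
    rw [mul_comm] at this
    omega
  · intro m hm hm'
    have : ¬ r ∣ m := by
      rintro ⟨i, rfl⟩
      refine hm' ⟨i, ?_, rfl⟩
      simp only [Finset.coe_range, Set.mem_Iio, Finset.mem_range] at hm ⊢
      have := (Nat.le_div_iff_mul_le (Nat.pos_of_ne_zero hr)).2
        (by rw [mul_comm]; omega : i * r ≤ n)
      omega
    rw [PowerSeries.coeff_expand_of_not_dvd r hr _ this, zero_mul]
  · intro i hi
    have hle : r * i ≤ n := by
      have := Nat.mul_le_of_le_div r i n (by have := Finset.mem_range.1 hi; omega)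
      rwa [mul_comm] at this
    rw [PowerSeries.coeff_expand_mul, coeff_perSeries hp hq, binCoeff]
    push_cast [hle]
    rfl

/-- An upper bound for the partial sums `kaplanSum` with `t = ⌊n / r⌋ + 1` bounds all of them. -/
lemma kaplanSum_le {p q r : ℕ} (hp : 3 ≤ p) (hq : 3 ≤ q) (hr : max p q < r) (c : ℕ → ℤ)
    (hc : ∀ n, c n < 0 → 0 ≤ c (n + 1)) {A : ℤ} (hA0 : 0 ≤ A)
    (hA : ∀ n : ℕ, kaplanSum p q c r n (n / r + 1) ≤ A) (u : ℤ) (t : ℕ) :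
    kaplanSum p q c r u t ≤ A := by
  have hpq := add_lt_mul_of_three_le hp hq
  obtain ⟨hpr, hqr⟩ := max_lt_iff.1 hr
  have hpqZ : (0 : ℤ) < (p * q : ℕ) := by omega
  have window : ∀ (t : ℕ) (w : ℕ), w < r → u - r * t ≡ w [ZMOD (p * q : ℕ)] →
      kaplanSum p q c r u (t + 1) ≤ A := by
    intro t w hw huw
    have h := hA (w + r * t)
    rw [Nat.add_mul_div_left _ _ (by omega), Nat.div_eq_of_lt hw, zero_add] at h
    rwa [kaplanSum_congr p q c (Nat.ModEq.refl r) (v := ((w + r * t : ℕ) : ℤ))]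
    push_cast
    simpa using huw.add_right (r * t : ℤ)
  induction t with
  | zero => simpa [kaplanSum] using hA0
  | succ t ih =>
    obtain ⟨w, hw⟩ := Int.eq_ofNat_of_zero_le (Int.emod_nonneg (u - r * t) hpqZ.ne')
    have huw : u - r * t ≡ w [ZMOD (p * q : ℕ)] := by rw [← hw]; exact (Int.mod_modEq _ _).symm
    by_cases hwr : w < r
    · exact window t w hwr huw
    rw [kaplanSum_succ]
    have hper : perCoeff p q (u - r * t) = -(if w < p + q then 1 else 0) := by
      rw [perCoeff, hw, if_neg (by omega), zero_sub]
      congr 2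
      rw [eq_iff_iff]
      omega
    by_cases hwpq : w < p + q
    · rw [if_pos hwpq] at hper
      rcases lt_or_ge (c t) 0 with hneg | hnn
      · have huw' : u - r * (t + 1 : ℕ) ≡ (w - r : ℕ) [ZMOD (p * q : ℕ)] := by
          rw [Nat.cast_sub (not_lt.1 hwr), Nat.cast_succ, mul_add_one, ← sub_sub]
          exact huw.sub_right (r : ℤ)
        have h := window (t + 1) (w - r) (by omega) huw'
        have hper' : perCoeff p q (u - r * (t + 1 : ℕ)) = 1 := by
          rw [perCoeff_congr p q huw', perCoeff, Int.emod_eq_of_lt (by omega) (by omega),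
            if_pos (by omega), if_neg (by omega), sub_zero]
        rw [kaplanSum_succ, hper', kaplanSum_succ] at h
        have := hc t hneg
        omega
      · rw [hper]
        omega
    · rw [if_neg hwpq] at hper
      rw [hper]
      omega

lemma natDegree_ternaryId {p q r : ℕ} (hp : 0 < p) (hq : 0 < q) (hr : 0 < r)
    {Q : Polynomial ℤ} (hQ : ternaryId p q r Q) :
    Q.natDegree = (p - 1) * (q - 1) * (r - 1) := by
  have hm : ∀ d : ℕ, d ≠ 0 → ((X : Polynomial ℤ) ^ d - 1).Monic := fun d hd => by
    simpa using monic_X_pow_sub_C (1 : ℤ) hd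
  have hd : ∀ d : ℕ, ((X : Polynomial ℤ) ^ d - 1).natDegree = d := fun d => by
    simpa using natDegree_X_pow_sub_C (R := ℤ) (n := d) (r := 1)
  have hqr := hm (q * r) (by positivity)
  have hrp := hm (r * p) (by positivity)
  have hpq := hm (p * q) (by positivity)
  have h1 := hm 1 one_ne_zero
  have hpqr := hm (p * q * r) (by positivity)
  have hQ0 : Q ≠ 0 := by
    rintro rfl
    rw [ternaryId, zero_mul] at hQ
    exact (((hpqr.mul (hm r hr.ne')).mul (hm q hq.ne')).mul (hm p hp.ne')).ne_zero hQ.symm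
  have h := congrArg natDegree hQ
  rw [pow_one] at h1
  have hd1 := hd 1
  rw [pow_one] at hd1
  rw [mul_comm Q, (((hqr.mul hrp).mul hpq).mul h1).natDegree_mul' hQ0,
    ((hqr.mul hrp).mul hpq).natDegree_mul h1, (hqr.mul hrp).natDegree_mul hpq,
    hqr.natDegree_mul hrp, ((hpqr.mul (hm r hr.ne')).mul (hm q hq.ne')).natDegree_mul (hm p hp.ne'),
    (hpqr.mul (hm r hr.ne')).natDegree_mul (hm q hq.ne'), hpqr.natDegree_mul (hm r hr.ne'), hd1]
    at h
  simp only [hd] at h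
  zify [Nat.one_le_iff_ne_zero.2 hp.ne', Nat.one_le_iff_ne_zero.2 hq.ne',
    Nat.one_le_iff_ne_zero.2 hr.ne'] at h ⊢
  linear_combination h

lemma coeff_ternaryId_min {p q r : ℕ} (hp : 3 ≤ p) (hq : 3 ≤ q) (hpq : Nat.Coprime p q)
    (hr : max p q < r) {Q : Polynomial ℤ} (hQ : ternaryId p q r Q) :
    Q.coeff (min p q) = 0 := by
  have hne : p ≠ q := by
    rintro rfl
    rw [Nat.coprime_self] at hpq
    omega
  have hlt := add_lt_mul_of_three_le hp hq
  rw [ternaryId_coeff hp hq (by omega) (by omega) hQ, Nat.div_eq_of_lt (by omega),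
    kaplanSum_succ, kaplanSum, Finset.sum_range_zero, perCoeff]
  rw [Nat.cast_zero, mul_zero, sub_zero, Int.emod_eq_of_lt (by omega) (by omega)]
  rcases lt_or_gt_of_ne hne with h | h
  · rw [if_neg (by omega), if_neg (by omega)]
    simp
  · rw [if_pos (by omega), if_pos (by omega)]
    simp

lemma coeff_le_of_modEq {p q r s : ℕ} (hp : 3 ≤ p) (hq : 3 ≤ q) (hpq : Nat.Coprime p q)
    (hr : max p q < r) (hs : max p q < s) (hmod : r ≡ s [MOD p * q]) {Qr Qs : Polynomial ℤ}
    (hQr : ternaryId p q r Qr) (hQs : ternaryId p q s Qs) {A : ℤ}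
    (hA : ∀ m, Qr.coeff m ≤ A) (m : ℕ) : Qs.coeff m ≤ A := by
  have hq0 : q ≠ 0 := by omega
  rw [ternaryId_coeff hp hq hq0 (by omega) hQs,
    kaplanSum_congr p q _ hmod.symm (Int.ModEq.refl (m : ℤ))]
  refine kaplanSum_le hp hq hr _ (binCoeff_succ_nonneg p q hq0 hpq) ?_ (fun n => ?_) _ _
  · exact (coeff_ternaryId_min hp hq hpq hr hQr).symm.trans_le (hA _)
  · rw [← ternaryId_coeff hp hq hq0 (by omega) hQr]
    exact hA n

lemma le_coeff_of_modEq {p q r s : ℕ} (hp : 3 ≤ p) (hq : 3 ≤ q) (hpq : Nat.Coprime p q)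
    (hr : max p q < r) (hs : max p q < s) (hmod : r ≡ s [MOD p * q]) {Qr Qs : Polynomial ℤ}
    (hQr : ternaryId p q r Qr) (hQs : ternaryId p q s Qs) {A : ℤ}
    (hA : ∀ m, A ≤ Qr.coeff m) (m : ℕ) : A ≤ Qs.coeff m := by
  have hq0 : q ≠ 0 := by omega
  rw [ternaryId_coeff hp hq hq0 (by omega) hQs,
    kaplanSum_congr p q _ hmod.symm (Int.ModEq.refl (m : ℤ)), ← neg_le_neg_iff, ← kaplanSum_neg]
  refine kaplanSum_le hp hq hr _ (fun n hn => ?_) ?_ (fun n => ?_) _ _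
  · have := binCoeff_succ_nonpos p q hq0 hpq n (by omega)
    omega
  · have := (hA _).trans_eq (coeff_ternaryId_min hp hq hpq hr hQr)
    omega
  · rw [kaplanSum_neg, ← ternaryId_coeff hp hq hq0 (by omega) hQr]
    exact neg_le_neg (hA n)

lemma coeff_mem_of_ternaryId {p q r : ℕ} (hp : 3 ≤ p) (hq : 3 ≤ q) (hpq : Nat.Coprime p q)
    (hr : max p q < r) {Q : Polynomial ℤ} (hQ : ternaryId p q r Q) (m : ℕ) :
    Q.coeff m ∈ {a : ℤ | ∃ m ≤ (p - 1) * (q - 1) * (r - 1), Q.coeff m = a} := by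
  by_cases hm : m ≤ (p - 1) * (q - 1) * (r - 1)
  · exact ⟨m, hm, rfl⟩
  · refine ⟨min p q, ?_, ?_⟩
    · calc min p q ≤ 1 * 1 * (r - 1) := by omega
        _ ≤ (p - 1) * (q - 1) * (r - 1) := by gcongr <;> omega
    · rw [coeff_ternaryId_min hp hq hpq hr hQ, coeff_eq_zero_of_natDegree_lt]
      rw [natDegree_ternaryId (by omega) (by omega) (by omega) hQ]
      omega

/-- If `r, s > max(p,q)` and `r ≡ s (mod pq)`, then `A⁺(p,q,r) = A⁺(p,q,s)` and
`A⁻(p,q,r) = A⁻(p,q,s)`. -/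
theorem stmt_19 (p q r s : ℕ) (hp : 3 ≤ p) (hq : 3 ≤ q) (hr3 : 3 ≤ r) (hs3 : 3 ≤ s)
    (hpq : Nat.Coprime p q) (hrc : Nat.Coprime r (p * q)) (hsc : Nat.Coprime s (p * q))
    (hrmax : max p q < r) (hsmax : max p q < s)
    (hmod : r ≡ s [MOD p * q])
    (Qr Qs : Polynomial ℤ) (hQr : ternaryId p q r Qr) (hQs : ternaryId p q s Qs)
    (Apr Aps Amr Ams : ℤ)
    (h1 : IsGreatest {a : ℤ | ∃ m ≤ (p - 1) * (q - 1) * (r - 1), Qr.coeff m = a} Apr)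
    (h2 : IsGreatest {a : ℤ | ∃ m ≤ (p - 1) * (q - 1) * (s - 1), Qs.coeff m = a} Aps)
    (h3 : IsLeast {a : ℤ | ∃ m ≤ (p - 1) * (q - 1) * (r - 1), Qr.coeff m = a} Amr)
    (h4 : IsLeast {a : ℤ | ∃ m ≤ (p - 1) * (q - 1) * (s - 1), Qs.coeff m = a} Ams) :
    Apr = Aps ∧ Amr = Ams := by
  have hr := coeff_mem_of_ternaryId hp hq hpq hrmax hQr
  have hs := coeff_mem_of_ternaryId hp hq hpq hsmax hQs
  obtain ⟨⟨m1, -, rfl⟩, h1⟩ := h1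
  obtain ⟨⟨m2, -, rfl⟩, h2⟩ := h2
  obtain ⟨⟨m3, -, rfl⟩, h3⟩ := h3
  obtain ⟨⟨m4, -, rfl⟩, h4⟩ := h4
  refine ⟨le_antisymm ?_ ?_, le_antisymm ?_ ?_⟩
  · exact coeff_le_of_modEq hp hq hpq hsmax hrmax hmod.symm hQs hQr (fun m => h2 (hs m)) _
  · exact coeff_le_of_modEq hp hq hpq hrmax hsmax hmod hQr hQs (fun m => h1 (hr m)) _
  · exact le_coeff_of_modEq hp hq hpq hrmax hsmax hmod hQr hQs (fun m => h3 (hr m)) _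
  · exact le_coeff_of_modEq hp hq hpq hsmax hrmax hmod.symm hQs hQr (fun m => h4 (hs m)) _
end
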